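/- Let R be a commutative noetherian local ring of Krull dimension d, and let A be a Noether R-algebra which is Iwanaga–Gorenstein, i.e., A has finite injective dimension both as a right A-module and as a left A-module. Let N be a finitely generated right A-module such that Ext^i_A(N, A) = 0 for all i > 0 and N is not projective, and let 0 → K → P → N → 0 be any short exact sequence of right A-modules with P finitely generated projective. Then Ext^{d+1}_A(A/rad A, K) ≠ 0. -/

import Mathlib

open CategoryTheory

universe u

/-- The Jacobson radical `rad A` (the intersection of the maximal left ideals of `A`,
a two-sided ideal), viewed as a submodule of the right regular module `A`
(formalized as the left regular `Aᵐᵒᵖ`-module). -/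
def radRight (A : Type u) [Ring A] : Submodule Aᵐᵒᵖ Aᵐᵒᵖ where
  carrier := {x | x.unop ∈ TwoSidedIdeal.jacobson (⊥ : TwoSidedIdeal A)}
  add_mem' := by
    intro x y hx hy
    simp only [Set.mem_setOf_eq, MulOpposite.unop_add] at *
    exact TwoSidedIdeal.add_mem _ hx hy
  zero_mem' := by
    simp only [Set.mem_setOf_eq, MulOpposite.unop_zero]
    exact TwoSidedIdeal.zero_mem _
  smul_mem' := by
    intro c x hx
    simp only [Set.mem_setOf_eq] at *
    exact (TwoSidedIdeal.jacobson (⊥ : TwoSidedIdeal A)).mul_mem_right _ _ hx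

/-- `A/rad A`, regarded as a right `A`-module (i.e. a left `Aᵐᵒᵖ`-module). -/
abbrev modRad (A : Type u) [Ring A] := Aᵐᵒᵖ ⧸ radRight A

/-- `Ext^n` in the category of modules over a ring `B`; taking `B = Aᵐᵒᵖ` gives the
Ext groups of right `A`-modules. -/
noncomputable abbrev extGrp (B : Type u) [Ring B] (n : ℕ) (X Y : ModuleCat.{u} B) :
    ModuleCat ℤ :=
  ((Ext ℤ (ModuleCat.{u} B) n).obj (Opposite.op X)).obj Y

/-- A module `M` has injective dimension `≤ d` iff `Ext^i(N, M) = 0` for all `i > d` and all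
modules `N` (the standard characterization, equivalent to the existence of an injective
resolution of length `d`). -/
def hasInjDimLE (B : Type u) [Ring B] (d : ℕ) (M : ModuleCat.{u} B) : Prop :=
  ∀ i : ℕ, d < i → ∀ N : ModuleCat.{u} B, Subsingleton (extGrp B i N M)

open scoped ModuleCat.Algebra

namespace CategoryTheory.ProjectiveResolution

/-- The degree `n + 1` homology of `Hom(P, Y)` vanishes iff every cocycle is a coboundary. -/
theorem exactAt_linearYonedaObj_iff {C : Type*} [Category* C] [Abelian C] [Linear ℤ C]
    {X : C} (P : ProjectiveResolution X) (Y : C) (n : ℕ) :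
    (P.complex.linearYonedaObj ℤ Y).ExactAt (n + 1) ↔
      ∀ f : P.complex.X (n + 1) ⟶ Y, P.complex.d (n + 2) (n + 1) ≫ f = 0 →
        ∃ g : P.complex.X n ⟶ Y, P.complex.d (n + 1) n ≫ g = f := by
  rw [HomologicalComplex.exactAt_iff' _ n (n + 1) (n + 2) (by simp) (by simp),
    ShortComplex.moduleCat_exact_iff]
  rfl

/-- The two definitions of `Ext` in Mathlib vanish simultaneously. -/
theorem isZero_ext_iff_subsingleton {C : Type*} [Category* C] [Abelian C] [Linear ℤ C]
    [EnoughProjectives C] [HasExt C] (X Y : C) (n : ℕ) :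
    Limits.IsZero (((Ext ℤ C (n + 1)).obj (Opposite.op X)).obj Y) ↔
      Subsingleton (Abelian.Ext X Y (n + 1)) := by
  let P := projectiveResolution X
  rw [(P.isoExt (n + 1) Y).isZero_iff, ← HomologicalComplex.exactAt_iff_isZero_homology,
    exactAt_linearYonedaObj_iff]
  constructor
  · refine fun h ↦ subsingleton_of_forall_eq 0 fun e ↦ ?_
    obtain ⟨f, hf, rfl⟩ := P.extMk_surjective e (n + 2) rfl
    exact (P.extMk_eq_zero_iff f _ rfl hf n rfl).2 (h f hf)
  · intro h f hf
    exact (P.extMk_eq_zero_iff f _ rfl hf n rfl).1 (Subsingleton.elim _ _)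

end CategoryTheory.ProjectiveResolution

theorem subsingleton_extGrp_iff {B : Type u} [Ring B] (X Y : ModuleCat.{u} B) (n : ℕ) :
    Subsingleton (extGrp B (n + 1) X Y) ↔ Subsingleton (Abelian.Ext X Y (n + 1)) := by
  rw [← ProjectiveResolution.isZero_ext_iff_subsingleton]
  exact ModuleCat.isZero_iff_subsingleton.symm

namespace CategoryTheory.ShortComplex.ShortExact

open Abelian

variable {C : Type*} [Category* C] [Abelian C] [HasExt C] {S : ShortComplex C}

theorem subsingleton_ext_X₁ (hS : S.ShortExact) (Y : C) (n : ℕ)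
    (h₂ : Subsingleton (Ext S.X₂ Y n)) (h₃ : Subsingleton (Ext S.X₃ Y (n + 1))) :
    Subsingleton (Ext S.X₁ Y n) := by
  refine subsingleton_of_forall_eq 0 fun e ↦ ?_
  obtain ⟨x, rfl⟩ := Ext.contravariant_sequence_exact₁ hS Y e (add_comm 1 n)
    (Subsingleton.elim _ _)
  rw [Subsingleton.elim x 0, Ext.comp_zero]

theorem subsingleton_ext_X₂ (hS : S.ShortExact) (Y : C) (n : ℕ)
    (h₁ : Subsingleton (Ext S.X₁ Y n)) (h₃ : Subsingleton (Ext S.X₃ Y n)) :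
    Subsingleton (Ext S.X₂ Y n) := by
  refine subsingleton_of_forall_eq 0 fun e ↦ ?_
  obtain ⟨x, rfl⟩ := Ext.contravariant_sequence_exact₂ hS Y e (Subsingleton.elim _ _)
  rw [Subsingleton.elim x 0, Ext.comp_zero]

theorem subsingleton_ext_X₃ (hS : S.ShortExact) (Y : C) (n : ℕ)
    (h₁ : Subsingleton (Ext S.X₁ Y n)) (h₂ : Subsingleton (Ext S.X₂ Y (n + 1))) :
    Subsingleton (Ext S.X₃ Y (n + 1)) := by
  refine subsingleton_of_forall_eq 0 fun e ↦ ?_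
  obtain ⟨x, rfl⟩ := Ext.contravariant_sequence_exact₃ hS Y e (Subsingleton.elim _ _)
    (add_comm 1 n)
  rw [Subsingleton.elim x 0, Ext.comp_zero]

/-- If `Ext¹(S.X₃, Y) = 0`, morphisms to `Y` extend along `S.f`. -/
theorem exists_extension_of_subsingleton_ext (hS : S.ShortExact) {Y : C}
    (h₃ : Subsingleton (Ext S.X₃ Y 1)) (f : S.X₁ ⟶ Y) : ∃ g : S.X₂ ⟶ Y, S.f ≫ g = f := by
  obtain ⟨x, hx⟩ := Ext.contravariant_sequence_exact₁ hS Y (Ext.mk₀ f) (add_zero 1)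
    (Subsingleton.elim _ _)
  obtain ⟨g, rfl⟩ := Ext.addEquiv₀.symm.surjective x
  refine ⟨g, Ext.addEquiv₀.symm.injective ?_⟩
  simpa using hx

/-- If `S.X₂` is acyclic for `Ext¹(-, Y)` and morphisms to `Y` extend along `S.f`, then
`Ext¹(S.X₃, Y) = 0`. -/
theorem subsingleton_ext_one_of_exists_extension (hS : S.ShortExact) {Y : C}
    (h₂ : Subsingleton (Ext S.X₂ Y 1)) (h : ∀ f : S.X₁ ⟶ Y, ∃ g : S.X₂ ⟶ Y, S.f ≫ g = f) :
    Subsingleton (Ext S.X₃ Y 1) := by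
  refine subsingleton_of_forall_eq 0 fun e ↦ ?_
  obtain ⟨x, rfl⟩ := Ext.contravariant_sequence_exact₃ hS Y e (Subsingleton.elim _ _) (add_zero 1)
  obtain ⟨f, rfl⟩ := Ext.addEquiv₀.symm.surjective x
  obtain ⟨g, rfl⟩ := h f
  have : Ext.addEquiv₀.symm (S.f ≫ g) =
      (Ext.mk₀ S.f).comp (Ext.mk₀ g) (zero_add 0) := by simp
  rw [this, hS.extClass_comp_assoc]

end CategoryTheory.ShortComplex.ShortExact

namespace LinearMap

variable {B : Type u} [Ring B] {X Y Z : Type u} [AddCommGroup X] [AddCommGroup Y]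
  [AddCommGroup Z] [Module B X] [Module B Y] [Module B Z]

/-- The short complex of modules attached to an exact pair of linear maps. -/
abbrev shortComplexOfExact (f : X →ₗ[B] Y) (g : Y →ₗ[B] Z) (h : Function.Exact f g) :
    ShortComplex (ModuleCat.{u} B) :=
  .mk (ModuleCat.ofHom f) (ModuleCat.ofHom g) (by ext x; exact h.apply_apply_eq_zero x)

theorem shortExact_shortComplexOfExact {f : X →ₗ[B] Y} {g : Y →ₗ[B] Z}
    (h : Function.Exact f g) (hf : Function.Injective f) (hg : Function.Surjective g) :
    (shortComplexOfExact f g h).ShortExact where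
  exact := (ShortComplex.ShortExact.moduleCat_exact_iff_function_exact _).mpr h
  mono_f := (ModuleCat.mono_iff_injective _).2 hf
  epi_g := (ModuleCat.epi_iff_surjective _).2 hg

end LinearMap

section NoetherAlgebra

variable {R : Type u} [CommRing R] {B : Type u} [Ring B] [Algebra R B]

/-- Multiplication by an element of the base ring of an algebra, as an endomorphism of a module. -/
def algebraMapEnd (B : Type*) [Ring B] [Algebra R B] (L : Type*) [AddCommGroup L] [Module B L]
    (x : R) : L →ₗ[B] L where
  toFun v := algebraMap R B x • v
  map_add' := smul_add _
  map_smul' b v := by simp only [smul_smul, Algebra.commutes, RingHom.id_apply]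

@[simp] theorem algebraMapEnd_apply {L : Type*} [AddCommGroup L] [Module B L] (x : R) (v : L) :
    algebraMapEnd B L x v = algebraMap R B x • v := rfl

theorem smul_id_eq_ofHom_algebraMapEnd (L : ModuleCat.{u} B) (x : R) :
    x • 𝟙 L = ModuleCat.ofHom (algebraMapEnd B L x) := by
  ext v
  simp

theorem Submodule.exact_subtype_mkQ {L : Type*} [AddCommGroup L] [Module B L]
    (p : Submodule B L) : Function.Exact p.subtype p.mkQ :=
  LinearMap.exact_iff.2 (by simp)

theorem comp_mk₀_algebraMapEnd (L M : ModuleCat.{u} B) (i : ℕ) (e : Abelian.Ext L M i) (x : R) :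
    e.comp (Abelian.Ext.mk₀ (ModuleCat.ofHom (algebraMapEnd B M x))) (add_zero i) =
      (Abelian.Ext.mk₀ (ModuleCat.ofHom (algebraMapEnd B L x))).comp e (zero_add i) := by
  rw [← smul_id_eq_ofHom_algebraMapEnd, ← smul_id_eq_ofHom_algebraMapEnd, Abelian.Ext.mk₀_smul,
    Abelian.Ext.mk₀_smul, Abelian.Ext.comp_smul, Abelian.Ext.smul_comp, Abelian.Ext.comp_mk₀_id,
    Abelian.Ext.mk₀_id_comp]

/-- A module over an `R`-algebra is `I`-power torsion if it is killed by a power of `I`. -/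
def IsPowTorsion (I : Ideal R) (L : ModuleCat.{u} B) : Prop :=
  ∃ k : ℕ, ∀ r ∈ I ^ k, ∀ v : L, algebraMap R B r • v = 0

namespace IsPowTorsion

variable {I : Ideal R} {L L' : ModuleCat.{u} B}

theorem of_injective (h : IsPowTorsion I L') (f : L →ₗ[B] L') (hf : Function.Injective f) :
    IsPowTorsion I L := by
  obtain ⟨k, hk⟩ := h
  exact ⟨k, fun r hr v ↦ hf (by rw [map_smul, hk r hr, map_zero])⟩

theorem of_surjective (h : IsPowTorsion I L) (f : L →ₗ[B] L') (hf : Function.Surjective f) :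
    IsPowTorsion I L' := by
  obtain ⟨k, hk⟩ := h
  refine ⟨k, fun r hr v ↦ ?_⟩
  obtain ⟨v, rfl⟩ := hf v
  rw [← map_smul, hk r hr, map_zero]

end IsPowTorsion

variable [Module.Finite R B]

variable (R B) in
theorem isNoetherianRing_of_finite_algebra [IsNoetherianRing R] : IsNoetherianRing B :=
  isNoetherian_of_tower R inferInstance

/-- Artin–Rees: an `I`-power torsion submodule embeds into an `I`-power torsion quotient. -/
theorem exists_disjoint_isPowTorsion_quotient [IsNoetherianRing R] (I : Ideal R)
    (W : Type u) [AddCommGroup W] [Module B W] [Module.Finite B W] (Q : Submodule B W)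
    (hQ : IsPowTorsion I (ModuleCat.of B Q)) :
    ∃ p : Submodule B W, Disjoint p Q ∧ IsPowTorsion I (ModuleCat.of B (W ⧸ p)) := by
  let : Module R W := Module.compHom W (algebraMap R B)
  have hs (r : R) (v : W) : algebraMap R B r • v = r • v := rfl
  have : IsScalarTower R B W := ⟨fun r b v ↦ by rw [Algebra.smul_def, mul_smul, hs]⟩
  have : Module.Finite R W := Module.Finite.trans B W
  obtain ⟨k, hk⟩ := hQ
  replace hk (r : R) (hr : r ∈ I ^ k) (w : W) (hw : w ∈ Q) : algebraMap R B r • w = 0 :=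
    congr_arg Q.subtype (hk r hr (⟨w, hw⟩ : Q))
  obtain ⟨l, hl⟩ := Ideal.exists_pow_inf_eq_pow_smul I (Q.restrictScalars R)
  obtain ⟨p, hp⟩ : ∃ p : Submodule B W, ∀ v, v ∈ p ↔ v ∈ I ^ (k + l) • (⊤ : Submodule R W) := by
    refine ⟨{ (I ^ (k + l) • (⊤ : Submodule R W)) with
      smul_mem' := by
        intro b v hv
        change b • v ∈ (I ^ (k + l) • (⊤ : Submodule R W))
        refine Submodule.smul_induction_on (p := fun v ↦ b • v ∈ I ^ (k + l) • ⊤) hv ?_ ?_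
        · intro r hr w _
          rw [← hs, smul_smul, ← Algebra.commutes, ← smul_smul, hs]
          exact Submodule.smul_mem_smul hr trivial
        · intro v w hv hw
          rw [smul_add]
          exact add_mem hv hw }, fun v ↦ Iff.rfl⟩
  refine ⟨p, Submodule.disjoint_def.2 fun v hv hvQ ↦ ?_, k + l, fun r hr v ↦ ?_⟩
  · have h : v ∈ I ^ (k + l) • (⊤ : Submodule R W) ⊓ Q.restrictScalars R := ⟨(hp v).1 hv, hvQ⟩
    rw [hl _ (Nat.le_add_left _ _), Nat.add_sub_cancel] at h
    have h' : I ^ k • (I ^ l • ⊤ ⊓ Q.restrictScalars R) ≤ ⊥ := by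
      refine Submodule.smul_le.2 fun r hr w hw ↦ ?_
      rw [Submodule.mem_bot, ← hs]
      exact hk r hr w hw.2
    exact h' h
  · obtain ⟨v, rfl⟩ := p.mkQ_surjective v
    rw [← map_smul]
    have h : algebraMap R B r • v ∈ p :=
      (hp _).2 <| Submodule.smul_mem_smul hr (Submodule.mem_top (R := R) (x := v))
    exact (Submodule.Quotient.mk_eq_zero _).2 h

section

variable {X Y Z : Type u} [AddCommGroup X] [AddCommGroup Y] [AddCommGroup Z]
  [Module B X] [Module B Y] [Module B Z] {f : X →ₗ[B] Y} {g : Y →ₗ[B] Z}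

/-- Pushing out a short exact sequence along a quotient map of the submodule. -/
theorem exists_shortExact_quotient (h : Function.Exact f g) (hf : Function.Injective f)
    (hg : Function.Surjective g) (p : Submodule B X) :
    ∃ (f' : (X ⧸ p) →ₗ[B] (Y ⧸ p.map f)) (g' : (Y ⧸ p.map f) →ₗ[B] Z), Function.Exact f' g' ∧
      Function.Injective f' ∧ Function.Surjective g' ∧ f' ∘ₗ p.mkQ = (p.map f).mkQ ∘ₗ f ∧
        g' ∘ₗ (p.map f).mkQ = g := by
  refine ⟨p.mapQ _ f (Submodule.le_comap_map f p), (p.map f).liftQ g ?_, ?_, ?_, ?_, ?_, ?_⟩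
  · rw [Submodule.map_le_iff_le_comap]
    intro x _
    exact h.apply_apply_eq_zero x
  · intro y
    obtain ⟨y, rfl⟩ := Submodule.mkQ_surjective _ y
    simp only [Submodule.mkQ_apply, Submodule.liftQ_apply, Set.mem_range]
    rw [h y]
    constructor
    · rintro ⟨x, rfl⟩
      exact ⟨p.mkQ x, rfl⟩
    · rintro ⟨x, hx⟩
      obtain ⟨x, rfl⟩ := p.mkQ_surjective x
      simp only [Submodule.mkQ_apply, Submodule.mapQ_apply, Submodule.Quotient.eq] at hx
      obtain ⟨x', -, hx'⟩ := hx
      exact ⟨x - x', by rw [map_sub, hx']; abel⟩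
  · rw [← LinearMap.ker_eq_bot, Submodule.ker_mapQ, Submodule.comap_map_eq_of_injective hf]
    simp
  · intro z
    obtain ⟨y, rfl⟩ := hg z
    exact ⟨(p.map f).mkQ y, by simp⟩
  · rfl
  · exact Submodule.liftQ_mkQ _ _ _

/-- The quotient of a short exact sequence by a submodule of the middle term which meets the
first term trivially. -/
theorem exists_shortExact_quotient_of_disjoint (h : Function.Exact f g)
    (hf : Function.Injective f) (hg : Function.Surjective g) (p : Submodule B Y)
    (hp : Disjoint p (LinearMap.range f)) :
    ∃ (g' : (Y ⧸ p) →ₗ[B] (Z ⧸ p.map g)), Function.Exact (p.mkQ ∘ₗ f) g' ∧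
      Function.Injective (p.mkQ ∘ₗ f) ∧ Function.Surjective g' ∧
        g' ∘ₗ p.mkQ = (p.map g).mkQ ∘ₗ g := by
  refine ⟨p.mapQ _ g (Submodule.le_comap_map g p), ?_, ?_, ?_, rfl⟩
  · intro y
    obtain ⟨y, rfl⟩ := Submodule.mkQ_surjective _ y
    simp only [Submodule.mkQ_apply, Submodule.mapQ_apply, Set.mem_range, LinearMap.comp_apply,
      Submodule.Quotient.mk_eq_zero]
    constructor
    · rintro ⟨w, hw, hwy⟩
      obtain ⟨x, hx⟩ := (h (y - w)).1 (by rw [map_sub, hwy, sub_self])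
      exact ⟨x, by rw [hx, Submodule.Quotient.eq]; simpa using hw⟩
    · rintro ⟨x, hx⟩
      rw [Submodule.Quotient.eq] at hx
      exact ⟨y - f x, by rw [← neg_sub]; exact neg_mem hx, by
        rw [map_sub, h.apply_apply_eq_zero, sub_zero]⟩
  · rw [← LinearMap.ker_eq_bot, LinearMap.ker_comp, Submodule.ker_mkQ, Submodule.eq_bot_iff]
    intro x hx
    exact hf (by rw [map_zero]; exact Submodule.disjoint_def.1 hp _ hx ⟨x, rfl⟩)
  · intro z
    obtain ⟨z, rfl⟩ := Submodule.mkQ_surjective _ z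
    obtain ⟨y, rfl⟩ := hg z
    exact ⟨p.mkQ y, rfl⟩

end

open Abelian.Ext in
/-- If classes of degree `j` with values in `M` come from power torsion quotients, then classes of
degree `j + 1` come from extensions by a power torsion module. -/
theorem exists_eq_extClass_comp_of_forall_exists_quotient [IsNoetherianRing R] (I : Ideal R)
    (M : ModuleCat.{u} B) (j : ℕ)
    (hj : ∀ (Z : Type u) [AddCommGroup Z] [Module B Z] [Module.Finite B Z]
      (e : Abelian.Ext (ModuleCat.of B Z) M j), ∃ p : Submodule B Z,
        IsPowTorsion I (ModuleCat.of B (Z ⧸ p)) ∧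
        ∃ e' : Abelian.Ext (ModuleCat.of B (Z ⧸ p)) M j,
          (mk₀ (ModuleCat.ofHom p.mkQ)).comp e' (zero_add j) = e)
    (Z : Type u) [AddCommGroup Z] [Module B Z] [Module.Finite B Z]
    (e : Abelian.Ext (ModuleCat.of B Z) M (j + 1)) :
    ∃ (Q W : Type u) (_ : AddCommGroup Q) (_ : AddCommGroup W) (_ : Module B Q) (_ : Module B W)
      (f : Q →ₗ[B] W) (g : W →ₗ[B] Z) (h : Function.Exact f g) (hf : Function.Injective f)
      (hg : Function.Surjective g) (e' : Abelian.Ext (ModuleCat.of B Q) M j),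
      Module.Finite B W ∧ IsPowTorsion I (ModuleCat.of B Q) ∧
      (LinearMap.shortExact_shortComplexOfExact h hf hg).extClass.comp e' (add_comm 1 j) = e := by
  have := isNoetherianRing_of_finite_algebra R B
  obtain ⟨n, g, hg⟩ := Module.Finite.exists_fin' B Z
  have hex : Function.Exact (LinearMap.ker g).subtype g := LinearMap.exact_subtype_ker_map g
  have hinj : Function.Injective (LinearMap.ker g).subtype := Submodule.subtype_injective _
  have : Projective (ModuleCat.of B (Fin n → B)) :=
    (IsProjective.iff_projective (R := B) (Fin n → B)).1 inferInstance
  have hS := LinearMap.shortExact_shortComplexOfExact hex hinj hg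
  obtain ⟨x, rfl⟩ := contravariant_sequence_exact₃ hS M e
    ((Abelian.Ext.subsingleton_of_projective (ModuleCat.of B (Fin n → B)) M j).elim _ _)
    (add_comm 1 j)
  obtain ⟨p, hp, e', rfl⟩ := hj (LinearMap.ker g) x
  obtain ⟨f', g', h', hf', hg', hff, hgg⟩ := exists_shortExact_quotient hex hinj hg p
  refine ⟨_, _, _, _, _, _, f', g', h', hf', hg', e', inferInstance, hp, ?_⟩
  let φ : LinearMap.shortComplexOfExact _ _ hex ⟶ LinearMap.shortComplexOfExact _ _ h' :=
    { τ₁ := ModuleCat.ofHom p.mkQ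
      τ₂ := ModuleCat.ofHom (Submodule.mkQ _)
      τ₃ := 𝟙 _
      comm₁₂ := by ext1; exact hff
      comm₂₃ := by ext1; exact hgg }
  have := hS.extClass_naturality (LinearMap.shortExact_shortComplexOfExact h' hf' hg') φ
  rw [mk₀_id_comp] at this
  rw [← this]
  exact comp_assoc_of_second_deg_zero _ _ _ _

open Abelian.Ext in
/-- Ext classes with values in a power torsion module come from power torsion quotients. -/
theorem exists_quotient_isPowTorsion_of_ext [IsNoetherianRing R] (I : Ideal R)
    (M : ModuleCat.{u} B) (hM : IsPowTorsion I M) (j : ℕ)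
    (Z : Type u) [AddCommGroup Z] [Module B Z] [Module.Finite B Z]
    (e : Abelian.Ext (ModuleCat.of B Z) M j) : ∃ p : Submodule B Z,
      IsPowTorsion I (ModuleCat.of B (Z ⧸ p)) ∧
      ∃ e' : Abelian.Ext (ModuleCat.of B (Z ⧸ p)) M j,
        (mk₀ (ModuleCat.ofHom p.mkQ)).comp e' (zero_add j) = e := by
  induction j generalizing Z with
  | zero =>
    obtain ⟨f, rfl⟩ := addEquiv₀.symm.surjective e
    refine ⟨LinearMap.ker f.hom,
      hM.of_injective ((LinearMap.ker f.hom).liftQ f.hom le_rfl) ?_,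
      mk₀ (ModuleCat.ofHom ((LinearMap.ker f.hom).liftQ f.hom le_rfl)), ?_⟩
    · exact LinearMap.ker_eq_bot.1 (Submodule.ker_liftQ_eq_bot' _ _ rfl)
    · rw [mk₀_comp_mk₀]
      rfl
  | succ j ih =>
    obtain ⟨Q, W, _, _, _, _, f, g, h, hf, hg, e', _, hQ, rfl⟩ :=
      exists_eq_extClass_comp_of_forall_exists_quotient I M j ih Z e
    obtain ⟨p, hp, htors⟩ := exists_disjoint_isPowTorsion_quotient I W (LinearMap.range f)
      (hQ.of_surjective f.rangeRestrict f.surjective_rangeRestrict)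
    obtain ⟨g', h', hf', hg', hgg⟩ := exists_shortExact_quotient_of_disjoint h hf hg p hp
    have hS' := LinearMap.shortExact_shortComplexOfExact h' hf' hg'
    refine ⟨p.map g, htors.of_surjective g' hg', hS'.extClass.comp e' (add_comm 1 j), ?_⟩
    let φ : LinearMap.shortComplexOfExact _ _ h ⟶ LinearMap.shortComplexOfExact _ _ h' :=
      { τ₁ := 𝟙 _
        τ₂ := ModuleCat.ofHom (Submodule.mkQ _)
        τ₃ := ModuleCat.ofHom (Submodule.mkQ _)
        comm₁₂ := rfl
        comm₂₃ := by ext1; exact hgg }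
    have := (LinearMap.shortExact_shortComplexOfExact h hf hg).extClass_naturality hS' φ
    rw [comp_mk₀_id] at this
    rw [this]
    exact (comp_assoc _ _ _ _ _ (by lia)).symm

open Abelian.Ext in
/-- Positive degree classes on a power torsion module `Z` with values in a power torsion module are
effaced by an epimorphism from a power torsion module onto `Z`. -/
theorem exists_surjective_comp_eq_zero_of_isPowTorsion [IsNoetherianRing R] (I : Ideal R)
    (M : ModuleCat.{u} B) (hM : IsPowTorsion I M) (j : ℕ)
    (Z : Type u) [AddCommGroup Z] [Module B Z] [Module.Finite B Z]
    (hZ : IsPowTorsion I (ModuleCat.of B Z))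
    (e : Abelian.Ext (ModuleCat.of B Z) M (j + 1)) :
    ∃ (W : Type u) (_ : AddCommGroup W) (_ : Module B W) (g : W →ₗ[B] Z), Module.Finite B W ∧
      IsPowTorsion I (ModuleCat.of B W) ∧ Function.Surjective g ∧
      (mk₀ (ModuleCat.ofHom g)).comp e (zero_add _) = 0 := by
  obtain ⟨Q, W, _, _, _, _, f, g, h, hf, hg, e', _, hQ, rfl⟩ :=
    exists_eq_extClass_comp_of_forall_exists_quotient I M j
      (fun Z ↦ exists_quotient_isPowTorsion_of_ext I M hM j Z) Z e
  refine ⟨W, _, _, g, ‹_›, ?_, hg,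
    (LinearMap.shortExact_shortComplexOfExact h hf hg).comp_extClass_assoc _ _⟩
  obtain ⟨a, ha⟩ := hQ
  obtain ⟨b, hb⟩ := hZ
  refine ⟨a + b, fun r hr w ↦ ?_⟩
  rw [pow_add] at hr
  refine Submodule.mul_induction_on hr (fun s hs t ht ↦ ?_) fun s t hs ht ↦ ?_
  · obtain ⟨q, hq⟩ := (h (algebraMap R B t • w)).1 (by rw [map_smul]; exact hb t ht _)
    rw [map_mul, mul_smul, ← hq, ← map_smul]
    exact (congr_arg f (ha s hs q)).trans f.map_zero
  · rw [map_add, add_smul, hs, ht, add_zero]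

variable (B) in
theorem exists_injective_algebraMapEnd_quotient [IsNoetherianRing R] (M : Type u) [AddCommGroup M]
    [Module B M] [Module.Finite B M] (x : R) :
    ∃ n : ℕ, ∀ a : ℕ, Function.Injective
      (algebraMapEnd B (M ⧸ LinearMap.ker (algebraMapEnd B M (x ^ n))) (x ^ a)) := by
  have := isNoetherianRing_of_finite_algebra R B
  let φ : ℕ →o Submodule B M :=
    { toFun n := LinearMap.ker (algebraMapEnd B M (x ^ n))
      monotone' := monotone_nat_of_le_succ fun n v hv ↦ by
        rw [LinearMap.mem_ker, algebraMapEnd_apply] at hv ⊢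
        rw [pow_succ', map_mul, mul_smul, hv, smul_zero] }
  obtain ⟨n, hn⟩ := monotone_stabilizes_iff_noetherian.2 (inferInstanceAs (IsNoetherian B M)) φ
  refine ⟨n, fun a ↦ (injective_iff_map_eq_zero _).2 fun v hv ↦ ?_⟩
  obtain ⟨v, rfl⟩ := Submodule.mkQ_surjective _ v
  rw [algebraMapEnd_apply, ← map_smul, Submodule.mkQ_apply, Submodule.Quotient.mk_eq_zero,
    LinearMap.mem_ker, algebraMapEnd_apply, smul_smul, ← map_mul, ← pow_add] at hv
  have : v ∈ φ (n + a) := hv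
  rw [← hn _ (Nat.le_add_right n a)] at this
  exact (Submodule.Quotient.mk_eq_zero _).2 this

open Abelian.Ext in
/-- If `I` is generated up to radical by `n` elements on the support of `M`, then `Ext` classes of
degree greater than `n` on `I`-power torsion modules with values in `M` are effaced by epimorphisms
from `I`-power torsion modules. -/
theorem exists_surjective_comp_eq_zero_of_le_radical [IsNoetherianRing R] (I : Ideal R)
    (l : List R) (hl : ∀ x ∈ l, x ∈ I) (M : ModuleCat.{u} B) [Module.Finite B M] (J : Ideal R)
    (hJ : ∀ r ∈ J, ∀ v : M, algebraMap R B r • v = 0)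
    (hI : I ≤ (Ideal.span {x | x ∈ l} ⊔ J).radical) (i : ℕ) (hi : l.length ≤ i)
    (L : Type u) [AddCommGroup L] [Module B L] [Module.Finite B L]
    (hL : IsPowTorsion I (ModuleCat.of B L))
    (e : Abelian.Ext (ModuleCat.of B L) M (i + 1)) :
    ∃ (W : Type u) (_ : AddCommGroup W) (_ : Module B W) (g : W →ₗ[B] L), Module.Finite B W ∧
      IsPowTorsion I (ModuleCat.of B W) ∧ Function.Surjective g ∧
      (mk₀ (ModuleCat.ofHom g)).comp e (zero_add _) = 0 := by
  have := isNoetherianRing_of_finite_algebra R B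
  induction l generalizing M J i L with
  | nil =>
    refine exists_surjective_comp_eq_zero_of_isPowTorsion I M ?_ i L hL e
    obtain ⟨k, hk⟩ := Ideal.exists_pow_le_of_le_radical_of_fg hI (IsNoetherian.noetherian I)
    exact ⟨k, fun r hr v ↦ hJ r (by simpa using hk hr) v⟩
  | cons x l ih =>
    obtain ⟨i, rfl⟩ : ∃ i', i = i' + 1 := Nat.exists_eq_succ_of_ne_zero (by
      rw [List.length_cons] at hi; lia)
    have hi' : l.length ≤ i := by simpa using hi
    have hxI : x ∈ I := hl x (by simp)
    have hle (a : ℕ) : I ≤ (Ideal.span {y | y ∈ l} ⊔ (J ⊔ Ideal.span {x ^ a})).radical := by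
      refine hI.trans (Ideal.radical_le_radical_iff.2 (sup_le (Ideal.span_le.2 ?_) ?_))
      · intro y hy
        obtain rfl | hy := List.mem_cons.1 hy
        · exact ⟨a, (le_sup_right.trans le_sup_right : Ideal.span {y ^ a} ≤ _)
            (Ideal.mem_span_singleton_self _)⟩
        · exact Ideal.le_radical ((le_sup_left : Ideal.span {y | y ∈ l} ≤ _)
            (Ideal.subset_span hy))
      · exact (le_sup_left.trans le_sup_right).trans Ideal.le_radical
    have hkill {X : Type u} [AddCommGroup X] [Module B X] (a : ℕ)
        (h₁ : ∀ r ∈ J, ∀ v : X, algebraMap R B r • v = 0)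
        (h₂ : ∀ v : X, algebraMap R B (x ^ a) • v = 0) :
        ∀ r ∈ J ⊔ Ideal.span {x ^ a}, ∀ v : X, algebraMap R B r • v = 0 := by
      intro r hr v
      obtain ⟨s, hs, t, ht, rfl⟩ := Submodule.mem_sup.1 hr
      obtain ⟨c, rfl⟩ := Ideal.mem_span_singleton'.1 ht
      rw [map_add, add_smul, h₁ s hs, map_mul, mul_smul, h₂, smul_zero, add_zero]
    replace ih := ih fun y hy ↦ hl y (List.mem_cons_of_mem _ hy)
    obtain ⟨n, hn⟩ := exists_injective_algebraMapEnd_quotient B M x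
    obtain ⟨a, ha⟩ := hL
    set T := LinearMap.ker (algebraMapEnd B M (x ^ n))
    set φ := algebraMapEnd B (M ⧸ T) (x ^ a)
    have hS := LinearMap.shortExact_shortComplexOfExact T.exact_subtype_mkQ
      T.subtype_injective T.mkQ_surjective
    have hS' := LinearMap.shortExact_shortComplexOfExact (LinearMap.exact_map_mkQ_range φ)
      (hn a) (Submodule.mkQ_surjective _)
    obtain ⟨c, hc⟩ := covariant_sequence_exact₁ _ hS'
      (e.comp (mk₀ (ModuleCat.ofHom T.mkQ)) (add_zero _)) (by
        have h0 : algebraMapEnd B L (x ^ a) = 0 := by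
          ext v
          exact ha _ (Ideal.pow_mem_pow hxI a) v
        refine (comp_mk₀_algebraMapEnd _ _ _ _ _).trans ?_
        rw [h0, ModuleCat.ofHom_zero, mk₀_zero, zero_comp]) (n₀ := i + 1) rfl
    obtain ⟨W₁, _, _, g₁, _, hW₁, hg₁, hc₁⟩ := ih
      (ModuleCat.of B ((M ⧸ T) ⧸ LinearMap.range φ)) (J ⊔ Ideal.span {x ^ a})
      (hkill a (fun r hr v ↦ by
        obtain ⟨v, rfl⟩ := Submodule.mkQ_surjective _ v
        obtain ⟨v, rfl⟩ := Submodule.mkQ_surjective _ v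
        rw [← map_smul, ← map_smul, hJ r hr, map_zero, map_zero]) (fun v ↦ by
        obtain ⟨v, rfl⟩ := Submodule.mkQ_surjective _ v
        rw [← map_smul]
        exact (Submodule.Quotient.mk_eq_zero _).2 ⟨v, rfl⟩)) (hle a) i hi' L ⟨a, ha⟩ c
    obtain ⟨t, ht⟩ := covariant_sequence_exact₂ _ hS
      ((mk₀ (ModuleCat.ofHom g₁)).comp e (zero_add _)) (by
        refine (comp_assoc_of_third_deg_zero _ _ _ _).trans ?_
        refine (congr_arg (fun z ↦ (mk₀ (ModuleCat.ofHom g₁)).comp z (zero_add _)) hc).symm.trans ?_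
        rw [← comp_assoc _ _ _ (zero_add _) _ (by lia), hc₁, zero_comp])
    obtain ⟨W₂, _, _, g₂, _, hW₂, hg₂, ht₂⟩ := ih (ModuleCat.of B T) (J ⊔ Ideal.span {x ^ n})
      (hkill n (fun r hr v ↦ Subtype.ext (hJ r hr v)) (fun v ↦ Subtype.ext v.2)) (hle n)
      (i + 1) (by lia) W₁ hW₁ t
    refine ⟨W₂, _, _, g₁ ∘ₗ g₂, ‹_›, hW₂, hg₁.comp hg₂, ?_⟩
    rw [ModuleCat.ofHom_comp, ← mk₀_comp_mk₀, comp_assoc_of_second_deg_zero, ← ht,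
      ← comp_assoc_of_third_deg_zero]
    refine (congr_arg (fun z ↦ z.comp (mk₀ (ModuleCat.ofHom T.subtype)) (add_zero _)) ht₂).trans ?_
    rw [zero_comp]

open Abelian.Ext in
/-- If `I` is generated up to radical by `d` elements, then the vanishing of `Ext^{d+1}` on
`I`-power torsion modules implies the vanishing in higher degrees. -/
theorem subsingleton_ext_of_isPowTorsion_of_le [IsNoetherianRing R] (I : Ideal R)
    (l : List R) (hl : ∀ x ∈ l, x ∈ I) (hI : I ≤ (Ideal.span {x | x ∈ l}).radical)
    (K : ModuleCat.{u} B) [Module.Finite B K]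
    (hK : ∀ (L : Type u) [AddCommGroup L] [Module B L] [Module.Finite B L],
      IsPowTorsion I (ModuleCat.of B L) →
        Subsingleton (Abelian.Ext (ModuleCat.of B L) K (l.length + 1)))
    (i : ℕ) (hi : l.length ≤ i) (L : Type u) [AddCommGroup L] [Module B L] [Module.Finite B L]
    (hL : IsPowTorsion I (ModuleCat.of B L)) :
    Subsingleton (Abelian.Ext (ModuleCat.of B L) K (i + 1)) := by
  have := isNoetherianRing_of_finite_algebra R B
  induction i, hi using Nat.le_induction generalizing L with
  | base => exact hK L hL
  | succ i hi ih =>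
    refine subsingleton_of_forall_eq 0 fun e ↦ ?_
    obtain ⟨W, _, _, g, _, hW, hg, he⟩ := exists_surjective_comp_eq_zero_of_le_radical I l hl K ⊥
      (fun r hr v ↦ by rw [Ideal.mem_bot.1 hr, map_zero, zero_smul]) (by simpa using hI)
      (i + 1) (by lia) L hL e
    obtain ⟨c, rfl⟩ := contravariant_sequence_exact₃
      (LinearMap.shortExact_shortComplexOfExact (LinearMap.exact_subtype_ker_map g)
        (Submodule.subtype_injective _) hg) K e he (add_comm 1 (i + 1))
    rw [(ih (LinearMap.ker g) (hW.of_injective _ (Submodule.subtype_injective _))).elim c 0,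
      comp_zero]

theorem ModuleCat.finite_ext_of_finite_algebra [IsNoetherianRing R] (L K : ModuleCat.{u} B)
    [Module.Finite B L] [Module.Finite B K] (i : ℕ) : Module.Finite R (Abelian.Ext L K i) := by
  have := isNoetherianRing_of_finite_algebra R B
  obtain ⟨n, g, hg⟩ := Module.Finite.exists_fin' B L
  induction i generalizing L n with
  | zero =>
    have : Module.Finite R K := Module.Finite.trans B K
    let ev : (L ⟶ K) →ₗ[R] Fin n → K :=
      { toFun f j := f.hom (g (Pi.single j 1))
        map_add' f f' := rfl
        map_smul' r f := rfl }
    have hev : Function.Injective ev := by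
      intro f f' h
      ext v
      obtain ⟨w, rfl⟩ := hg v
      exact LinearMap.congr_fun (Module.Basis.ext (Pi.basisFun B (Fin n))
        (f₁ := f.hom ∘ₗ g) (f₂ := f'.hom ∘ₗ g) fun j ↦ by
          rw [LinearMap.comp_apply, LinearMap.comp_apply, Pi.basisFun_apply]
          exact congr_fun h j) w
    have := Module.Finite.of_injective ev hev
    exact Module.Finite.equiv (Abelian.Ext.linearEquiv₀ (R := R)).symm
  | succ i ih =>
    have hS := LinearMap.shortExact_shortComplexOfExact (LinearMap.exact_subtype_ker_map g)
      (Submodule.subtype_injective _) hg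
    have : Projective (ModuleCat.of B (Fin n → B)) :=
      (IsProjective.iff_projective (R := B) (Fin n → B)).1 inferInstance
    obtain ⟨n', g', hg'⟩ := Module.Finite.exists_fin' B (LinearMap.ker g)
    have := ih (ModuleCat.of B (LinearMap.ker g)) n' g' hg'
    refine Module.Finite.of_surjective
      (hS.extClass.precompOfLinear R K (add_comm 1 i)) fun e ↦ ?_
    exact Abelian.Ext.contravariant_sequence_exact₃ hS K e
      ((Abelian.Ext.subsingleton_of_projective (ModuleCat.of B (Fin n → B)) K i).elim _ _)
      (add_comm 1 i)

variable [IsLocalRing R]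

open IsLocalRing

/-- A finitely generated module over a Noether algebra which is killed by the maximal ideal of
the base is artinian. -/
theorem isArtinian_of_maximalIdeal_smul_eq_zero {L : Type*} [AddCommGroup L] [Module B L]
    [Module.Finite B L] (h : ∀ r ∈ maximalIdeal R, ∀ v : L, algebraMap R B r • v = 0) :
    IsArtinian B L := by
  let : Module R L := Module.compHom L (algebraMap R B)
  have : IsScalarTower R B L := ⟨fun r b v ↦ by rw [Algebra.smul_def, mul_smul]; rfl⟩
  have : Module.Finite R L := Module.Finite.trans B L
  have hL : Module.IsTorsionBySet R L (maximalIdeal R : Set R) := fun v r ↦ h r r.2 v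
  let := hL.module
  have : IsScalarTower R (R ⧸ maximalIdeal R) L := hL.isScalarTower
  have : Module.Finite (R ⧸ maximalIdeal R) L := .of_restrictScalars_finite R _ L
  let := Ideal.Quotient.field (maximalIdeal R)
  have hk : IsArtinian (R ⧸ maximalIdeal R) L := inferInstance
  have : IsArtinian R L := isArtinian_of_surjective_algebraMap (R := R ⧸ maximalIdeal R)
    Ideal.Quotient.mk_surjective
  exact isArtinian_of_tower R inferInstance

/-- Dévissage: a property of modules which holds for simple modules, is stable under extensions,
and descends along quotients by a regular element of the maximal ideal, holds for all finitely
generated modules. -/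
theorem ModuleCat.induction_of_finite [IsNoetherianRing R] {P : ModuleCat.{u} B → Prop}
    (zero : ∀ L : ModuleCat.{u} B, Subsingleton L → P L)
    (simple : ∀ L : ModuleCat.{u} B, IsSimpleModule B L → P L)
    (extension : ∀ S : ShortComplex (ModuleCat.{u} B), S.ShortExact → P S.X₁ → P S.X₃ → P S.X₂)
    (regular : ∀ L : ModuleCat.{u} B, Module.Finite B L → ∀ x ∈ maximalIdeal R,
      Function.Injective (algebraMapEnd B L x) →
      P (ModuleCat.of B (L ⧸ LinearMap.range (algebraMapEnd B L x))) → P L)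
    (L : ModuleCat.{u} B) [Module.Finite B L] : P L := by
  have := isNoetherianRing_of_finite_algebra R B
  suffices H : ∀ p : Submodule B L, ∀ (L' : ModuleCat.{u} B) (f : L →ₗ[B] L'),
      Function.Surjective f → LinearMap.ker f = p → P L' from
    H _ L LinearMap.id Function.surjective_id rfl
  intro p
  induction p using IsNoetherian.induction with | hgt p ih =>
  rintro L' f hf rfl
  have : Module.Finite B L' := .of_surjective f hf
  have quotient (L'' : ModuleCat.{u} B) (g : L' →ₗ[B] L'') (hg : Function.Surjective g)
      (w : L') (hw : w ≠ 0) (hgw : g w = 0) : P L'' := by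
    refine ih _ (lt_of_le_of_ne (LinearMap.ker_le_ker_comp f g) fun h ↦ hw ?_) L'' (g ∘ₗ f)
      (hg.comp hf) rfl
    obtain ⟨v, rfl⟩ := hf w
    exact LinearMap.mem_ker.1 (h.ge (LinearMap.mem_ker.2 hgw))
  obtain hL | hL := subsingleton_or_nontrivial L'
  · exact zero _ hL
  by_cases hx : ∃ x ∈ maximalIdeal R, ∃ v : L', algebraMap R B x • v ≠ 0
  · obtain ⟨x, hx, v, hv⟩ := hx
    set φ := algebraMapEnd B L' x
    have hcoker : P (ModuleCat.of B (L' ⧸ LinearMap.range φ)) :=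
      quotient _ (Submodule.mkQ _) (Submodule.mkQ_surjective _) _ hv
        ((Submodule.Quotient.mk_eq_zero _).2 ⟨v, rfl⟩)
    by_cases hφ : Function.Injective φ
    · exact regular L' inferInstance x hx hφ hcoker
    · rw [← LinearMap.ker_eq_bot, Submodule.eq_bot_iff] at hφ
      push Not at hφ
      obtain ⟨w, hw, hw0⟩ := hφ
      refine extension _ (LinearMap.shortExact_shortComplexOfExact
        (LinearMap.range φ).exact_subtype_mkQ (Submodule.subtype_injective _)
        (Submodule.mkQ_surjective _)) ?_ hcoker
      exact quotient _ φ.rangeRestrict φ.surjective_rangeRestrict w hw0 (Subtype.ext hw)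
  · push Not at hx
    have := isArtinian_of_maximalIdeal_smul_eq_zero hx
    obtain ⟨T, hT, -⟩ := (eq_bot_or_exists_atom_le (⊤ : Submodule B L')).resolve_left top_ne_bot
    obtain ⟨w, hwT, hw⟩ := T.ne_bot_iff.1 hT.1
    exact extension _ (LinearMap.shortExact_shortComplexOfExact T.exact_subtype_mkQ
      (Submodule.subtype_injective _) (Submodule.mkQ_surjective _))
      (simple _ (isSimpleModule_iff_isAtom.2 hT))
      (quotient _ T.mkQ T.mkQ_surjective w hw ((Submodule.Quotient.mk_eq_zero _).2 hwT))

/-- Nakayama's lemma for modules over an algebra over a local ring. -/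
theorem subsingleton_of_surjective_algebraMapEnd (L : Type*) [AddCommGroup L] [Module B L]
    [Module.Finite B L] {x : R} (hx : x ∈ maximalIdeal R)
    (h : Function.Surjective (algebraMapEnd B L x)) : Subsingleton L := by
  let : Module R L := Module.compHom L (algebraMap R B)
  have : IsScalarTower R B L := ⟨fun r b v ↦ by rw [Algebra.smul_def, mul_smul]; rfl⟩
  have : Module.Finite R L := Module.Finite.trans B L
  refine (Submodule.subsingleton_iff R).1 (subsingleton_of_bot_eq_top (Eq.symm ?_))
  refine Submodule.eq_bot_of_le_smul_of_le_jacobson_bot (maximalIdeal R) ⊤ Module.Finite.fg_top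
    (fun v _ ↦ ?_) (IsLocalRing.jacobson_eq_maximalIdeal ⊥ bot_ne_top).ge
  obtain ⟨w, rfl⟩ := h v
  exact Submodule.smul_mem_smul hx (Submodule.mem_top (x := w))

/-- The maximal ideal of the base ring kills simple modules over a finite algebra. -/
theorem algebraMap_smul_eq_zero_of_isSimpleModule (L : Type*) [AddCommGroup L] [Module B L]
    [IsSimpleModule B L] {x : R} (hx : x ∈ maximalIdeal R) (v : L) : algebraMap R B x • v = 0 := by
  have := IsSimpleModule.nontrivial B L
  obtain h | h := LinearMap.bijective_or_eq_zero (algebraMapEnd B L x)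
  · exact (not_subsingleton L (subsingleton_of_surjective_algebraMapEnd L hx h.2)).elim
  · exact LinearMap.congr_fun h v

/-- If `Ext^i(-, K)` vanishes on simple modules, it vanishes on finitely generated modules which
are power torsion for the maximal ideal. -/
theorem subsingleton_ext_of_isPowTorsion_of_simple [IsNoetherianRing R] (K : ModuleCat.{u} B)
    (i : ℕ) (h : ∀ T : ModuleCat.{u} B, IsSimpleModule B T → Subsingleton (Abelian.Ext T K i))
    (L : ModuleCat.{u} B) [Module.Finite B L] (hL : IsPowTorsion (maximalIdeal R) L) :
    Subsingleton (Abelian.Ext L K i) := by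
  have zero (L : ModuleCat.{u} B) (hL : Subsingleton L) : Subsingleton (Abelian.Ext L K i) := by
    refine subsingleton_of_forall_eq 0 fun e ↦ ?_
    rw [← Abelian.Ext.mk₀_id_comp e, (ModuleCat.isZero_of_subsingleton L).eq_of_src (𝟙 L) 0,
      Abelian.Ext.mk₀_zero, Abelian.Ext.zero_comp]
  revert hL
  refine ModuleCat.induction_of_finite (R := R)
    (P := fun L ↦ IsPowTorsion (maximalIdeal R) L → Subsingleton (Abelian.Ext L K i))
    (fun L hL _ ↦ zero L hL) (fun T hT _ ↦ h T hT) (fun S hS h₁ h₃ hL ↦ ?_)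
    (fun L _ x hx hinj _ hL ↦ ?_) L
  · exact hS.subsingleton_ext_X₂ K i
      (h₁ (hL.of_injective S.f.hom hS.moduleCat_injective_f))
      (h₃ (hL.of_surjective S.g.hom hS.moduleCat_surjective_g))
  · obtain ⟨k, hk⟩ := hL
    have hinj' (n : ℕ) : Function.Injective (algebraMapEnd B L (x ^ n)) := by
      induction n with
      | zero => intro v w hvw; simpa using hvw
      | succ n ih =>
        intro v w hvw
        refine ih (hinj ?_)
        simpa only [algebraMapEnd_apply, pow_succ', map_mul, mul_smul] using hvw
    refine zero L ⟨fun v w ↦ hinj' k ?_⟩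
    rw [algebraMapEnd_apply, algebraMapEnd_apply, hk _ (Ideal.pow_mem_pow hx k),
      hk _ (Ideal.pow_mem_pow hx k)]

/-- If `Ext^i(-, K)` vanishes on simple modules for all `i > d`, then it vanishes on all finitely
generated modules for all `i > d`. -/
theorem subsingleton_ext_of_simple [IsNoetherianRing R] (K : ModuleCat.{u} B)
    [Module.Finite B K] (d : ℕ) (h : ∀ i, d ≤ i → ∀ T : ModuleCat.{u} B, IsSimpleModule B T →
      Subsingleton (Abelian.Ext T K (i + 1)))
    (L : ModuleCat.{u} B) [Module.Finite B L] (i : ℕ) (hi : d ≤ i) :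
    Subsingleton (Abelian.Ext L K (i + 1)) := by
  revert i
  refine ModuleCat.induction_of_finite (R := R)
    (P := fun L ↦ ∀ i, d ≤ i → Subsingleton (Abelian.Ext L K (i + 1)))
    (fun L hL i hi ↦ ?_) (fun T hT i hi ↦ h i hi T hT)
    (fun S hS h₁ h₃ i hi ↦ hS.subsingleton_ext_X₂ K _ (h₁ i hi) (h₃ i hi))
    (fun L _ x hx hinj hL i hi ↦ ?_) L
  · have := (ModuleCat.isZero_of_subsingleton L).projective
    exact Abelian.Ext.subsingleton_of_projective L K i
  · have := ModuleCat.finite_ext_of_finite_algebra (R := R) L K (i + 1)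
    have hS := LinearMap.shortExact_shortComplexOfExact
      (LinearMap.exact_map_mkQ_range (algebraMapEnd B L x)) hinj (Submodule.mkQ_surjective _)
    refine subsingleton_of_surjective_algebraMapEnd (R := R) (B := R) _ hx fun e ↦ ?_
    obtain ⟨c, hc⟩ := Abelian.Ext.contravariant_sequence_exact₁ hS K e (add_comm 1 (i + 1))
      ((hL (i + 1) (by lia)).elim _ _)
    refine ⟨c, Eq.trans ?_ hc⟩
    change x • c = (Abelian.Ext.mk₀ (ModuleCat.ofHom (algebraMapEnd B L x))).comp c _
    rw [← smul_id_eq_ofHom_algebraMapEnd, Abelian.Ext.mk₀_smul, Abelian.Ext.smul_comp,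
      Abelian.Ext.mk₀_id_comp]

variable (R) in
theorem exists_list_maximalIdeal_le_radical [IsNoetherianRing R] (d : ℕ)
    (hd : ringKrullDim R = (d : WithBot ℕ∞)) :
    ∃ l : List R, l.length = d ∧ (∀ x ∈ l, x ∈ maximalIdeal R) ∧
      maximalIdeal R ≤ (Ideal.span {x | x ∈ l}).radical := by
  obtain ⟨s, hs, hcard⟩ :=
    (maximalIdeal R).exists_finset_card_eq_height_of_isNoetherianRing
  refine ⟨s.toList, ?_, fun x hx ↦ hs.1.2 (Ideal.subset_span (Finset.mem_toList.1 hx)), ?_⟩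
  · rw [Finset.length_toList]
    rw [← maximalIdeal_height_eq_ringKrullDim, ← hcard] at hd
    exact_mod_cast hd
  · simp only [Finset.mem_toList]
    rw [Ideal.radical_eq_sInf]
    exact le_sInf fun q ⟨hq, hqp⟩ ↦ hs.2 ⟨hqp, hq⟩ (le_maximalIdeal hqp.ne_top)

/-- If `Ext^{d+1}(-, K)` vanishes on simple modules, where `d` is the Krull dimension of the base
ring, then `Ext^i(-, K)` vanishes on finitely generated modules for all `i > d`. -/
theorem subsingleton_ext_of_simple_of_ringKrullDim_eq [IsNoetherianRing R] (d : ℕ)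
    (hd : ringKrullDim R = (d : WithBot ℕ∞)) (K : ModuleCat.{u} B) [Module.Finite B K]
    (h : ∀ T : ModuleCat.{u} B, IsSimpleModule B T → Subsingleton (Abelian.Ext T K (d + 1)))
    (L : ModuleCat.{u} B) [Module.Finite B L] (i : ℕ) (hi : d ≤ i) :
    Subsingleton (Abelian.Ext L K (i + 1)) := by
  obtain ⟨l, rfl, hl, hm⟩ := exists_list_maximalIdeal_le_radical R d hd
  refine subsingleton_ext_of_simple (R := R) K l.length (fun i hi T hT ↦ ?_) L i hi
  exact subsingleton_ext_of_isPowTorsion_of_le (maximalIdeal R) l hl hm K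
    (fun L _ _ _ hL ↦ subsingleton_ext_of_isPowTorsion_of_simple (R := R) K _ h _ hL) i hi T
    ⟨1, fun r hr v ↦ algebraMap_smul_eq_zero_of_isSimpleModule T (by simpa using hr) v⟩

/-- The maximal ideal of the base ring is contained in the radical of a finite algebra. -/
theorem algebraMap_mem_jacobson (x : R) (hx : x ∈ maximalIdeal R) :
    algebraMap R B x ∈ Ring.jacobson B := by
  rw [Ring.jacobson_eq_sInf_isMaximal, Submodule.mem_sInf]
  intro p hp
  have : IsSimpleModule B (B ⧸ p) := isSimpleModule_iff_quot_maximal.2 ⟨p, hp, ⟨.refl _ _⟩⟩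
  have := algebraMap_smul_eq_zero_of_isSimpleModule (B := B) (B ⧸ p) hx (p.mkQ 1)
  rwa [← map_smul, smul_eq_mul, mul_one, Submodule.mkQ_apply,
    Submodule.Quotient.mk_eq_zero] at this

/-- Over a finite algebra over a local ring, `B / rad B` is semisimple. -/
theorem isSemisimpleModule_quotient_jacobson (R : Type u) [CommRing R] [IsLocalRing R]
    (B : Type u) [Ring B] [Algebra R B] [Module.Finite R B] :
    IsSemisimpleModule B (B ⧸ (Ring.jacobson B : Submodule B B)) := by
  have : IsArtinian B (B ⧸ (Ring.jacobson B : Submodule B B)) := by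
    refine isArtinian_of_maximalIdeal_smul_eq_zero (R := R) (B := B) fun r hr v ↦ ?_
    obtain ⟨v, rfl⟩ := Submodule.mkQ_surjective _ v
    rw [← map_smul, Submodule.mkQ_apply, Submodule.Quotient.mk_eq_zero, smul_eq_mul]
    exact Ideal.mul_mem_right _ _ (algebraMap_mem_jacobson r hr)
  exact (IsArtinian.isSemisimpleModule_iff_jacobson B _).2 (Module.jacobson_quotient_jacobson B B)

/-- If `Ext^i(B / rad B, K) = 0` then `Ext^i(-, K)` vanishes on simple modules. -/
theorem subsingleton_ext_of_quotient_jacobson (K : ModuleCat.{u} B) (i : ℕ)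
    (hss : IsSemisimpleModule B (B ⧸ (Ring.jacobson B : Submodule B B)))
    (h : Subsingleton
      (Abelian.Ext (ModuleCat.of B (B ⧸ (Ring.jacobson B : Submodule B B))) K i))
    (T : ModuleCat.{u} B) [IsSimpleModule B T] : Subsingleton (Abelian.Ext T K i) := by
  obtain ⟨p, hp, ⟨φ⟩⟩ := (isSimpleModule_iff_quot_maximal (R := B) (M := T)).1 inferInstance
  let π : (B ⧸ (Ring.jacobson B : Submodule B B)) →ₗ[B] T :=
    φ.symm.toLinearMap ∘ₗ Submodule.factor (Ring.jacobson_le_of_isMaximal p)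
  have hπ : Function.Surjective π := φ.symm.surjective.comp (Submodule.factor_surjective _)
  obtain ⟨s, hs⟩ := IsSemisimpleModule.lifting_property π hπ LinearMap.id
  refine subsingleton_of_forall_eq 0 fun e ↦ ?_
  have h₁ : (Abelian.Ext.mk₀ (ModuleCat.ofHom s)).comp
      ((Abelian.Ext.mk₀ (ModuleCat.ofHom π)).comp e (zero_add i)) (zero_add i) = e := by
    rw [← Abelian.Ext.comp_assoc_of_second_deg_zero, Abelian.Ext.mk₀_comp_mk₀,
      ← ModuleCat.ofHom_comp, hs]
    exact Abelian.Ext.mk₀_id_comp e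
  rw [← h₁, Subsingleton.elim ((Abelian.Ext.mk₀ (ModuleCat.ofHom π)).comp e (zero_add i)) 0,
    Abelian.Ext.comp_zero]

end NoetherAlgebra

theorem exists_mul_mul_add_of_mem_jacobson {S : Type*} [Ring S] {x : S} (hx : x ∈ Ring.jacobson S)
    (y : S) : ∃ z, x * y * z + z = 1 := by
  rw [← Ideal.jacobson_bot] at hx
  have left_inv {w : S} (hw : w - 1 ∈ (⊥ : Ideal S).jacobson) : ∃ z, z * w = 1 := by
    obtain ⟨z, hz⟩ := Ideal.exists_mul_sub_mem_of_sub_one_mem_jacobson w hw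
    exact ⟨z, sub_eq_zero.1 hz⟩
  have hxy : x * y ∈ (⊥ : Ideal S).jacobson := by
    rw [Ideal.jacobson_bot] at hx ⊢
    exact Ideal.mul_mem_right _ _ hx
  obtain ⟨z, hz⟩ := left_inv (w := x * y + 1) (by simpa using hxy)
  obtain ⟨w, hw⟩ := left_inv (w := z) (by
    have : z - 1 = -(z * (x * y)) := by
      rw [eq_neg_iff_add_eq_zero, sub_add_eq_add_sub, sub_eq_zero, ← hz, mul_add, mul_one, add_comm]
    rw [this]
    exact neg_mem (Ideal.mul_mem_left _ _ hxy))
  refine ⟨z, ?_⟩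
  have : w = x * y + 1 := left_inv_eq_right_inv hw hz
  rw [← hw, this, add_mul, one_mul]

theorem radRight_eq_jacobson (A : Type u) [Ring A] : radRight A = Ring.jacobson Aᵐᵒᵖ := by
  ext x
  change x.unop ∈ TwoSidedIdeal.jacobson (⊥ : TwoSidedIdeal A) ↔ _
  rw [← Ideal.jacobson_bot, Ideal.mem_jacobson_iff, TwoSidedIdeal.mem_jacobson_iff]
  constructor
  · intro h y
    have hx : x.unop ∈ Ring.jacobson A := by
      rw [← Ideal.jacobson_bot, Ideal.mem_jacobson_iff]
      simpa [TwoSidedIdeal.mem_bot] using h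
    obtain ⟨z, hz⟩ := exists_mul_mul_add_of_mem_jacobson hx y.unop
    refine ⟨MulOpposite.op z, ?_⟩
    rw [Ideal.mem_bot, sub_eq_zero]
    apply MulOpposite.unop_injective
    simpa [mul_assoc] using hz
  · intro h y
    have hx : x ∈ Ring.jacobson Aᵐᵒᵖ := by rwa [← Ideal.jacobson_bot, Ideal.mem_jacobson_iff]
    obtain ⟨z, hz⟩ := exists_mul_mul_add_of_mem_jacobson hx (MulOpposite.op y)
    refine ⟨z.unop, ?_⟩
    rw [TwoSidedIdeal.mem_bot, sub_eq_zero]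
    apply MulOpposite.op_injective
    simpa [mul_assoc] using hz

section Dual

variable {A : Type u} [Ring A] {X Y Z : Type u} [AddCommGroup X] [AddCommGroup Y] [AddCommGroup Z]
  [Module Aᵐᵒᵖ X] [Module Aᵐᵒᵖ Y] [Module Aᵐᵒᵖ Z]

variable (A) in
/-- A finitely generated right module `X` with `Ext^i(X, A) = 0` for all `i > 0`. -/
structure IsSemiGorensteinProjective (X : Type u) [AddCommGroup X] [Module Aᵐᵒᵖ X] : Prop where
  finite : Module.Finite Aᵐᵒᵖ X
  subsingleton_ext (i : ℕ) :
    Subsingleton (Abelian.Ext (ModuleCat.of Aᵐᵒᵖ X) (ModuleCat.of Aᵐᵒᵖ A) (i + 1))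

/-- Precomposition, as a map of left modules between the `A`-duals of right modules. -/
def rightDualMap (f : X →ₗ[Aᵐᵒᵖ] Y) : (Y →ₗ[Aᵐᵒᵖ] A) →ₗ[A] (X →ₗ[Aᵐᵒᵖ] A) where
  toFun h := h ∘ₗ f
  map_add' _ _ := rfl
  map_smul' _ _ := rfl

@[simp] theorem rightDualMap_apply (f : X →ₗ[Aᵐᵒᵖ] Y) (h : Y →ₗ[Aᵐᵒᵖ] A) :
    rightDualMap f h = h ∘ₗ f := rfl

/-- Evaluation at an element, as a functional on the `A`-dual of a right module. -/
def rightDualEval (x : X) : (X →ₗ[Aᵐᵒᵖ] A) →ₗ[A] A where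
  toFun h := h x
  map_add' _ _ := rfl
  map_smul' _ _ := rfl

@[simp] theorem rightDualEval_apply (x : X) (h : X →ₗ[Aᵐᵒᵖ] A) : rightDualEval x h = h x := rfl

section

variable {f : X →ₗ[Aᵐᵒᵖ] Y} {g : Y →ₗ[Aᵐᵒᵖ] Z}

theorem rightDualMap_injective (hg : Function.Surjective g) :
    Function.Injective (rightDualMap (A := A) g) := fun _ _ h ↦
  (LinearMap.cancel_right hg).1 h

theorem exact_rightDualMap (h : Function.Exact f g) (hg : Function.Surjective g) :
    Function.Exact (rightDualMap (A := A) g) (rightDualMap f) := by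
  intro k
  constructor
  · intro hk
    refine ⟨(LinearMap.ker g).liftQ k ?_ ∘ₗ (g.quotKerEquivOfSurjective hg).symm.toLinearMap, ?_⟩
    · rintro y hy
      obtain ⟨x, rfl⟩ := (h y).1 hy
      exact LinearMap.congr_fun hk x
    · ext y
      have : (g.quotKerEquivOfSurjective hg).symm (g y) = (LinearMap.ker g).mkQ y :=
        (g.quotKerEquivOfSurjective hg).symm_apply_eq.2 rfl
      simp [this]
  · rintro ⟨k, rfl⟩
    ext x
    simp [h.apply_apply_eq_zero x]

theorem rightDualMap_surjective (h : Function.Exact f g) (hf : Function.Injective f)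
    (hg : Function.Surjective g)
    (hZ : Subsingleton (Abelian.Ext (ModuleCat.of Aᵐᵒᵖ Z) (ModuleCat.of Aᵐᵒᵖ A) 1)) :
    Function.Surjective (rightDualMap (A := A) f) := by
  intro k
  obtain ⟨l, hl⟩ := (LinearMap.shortExact_shortComplexOfExact h hf hg)
    |>.exists_extension_of_subsingleton_ext hZ (ModuleCat.ofHom k)
  exact ⟨l.hom, congr_arg ModuleCat.Hom.hom hl⟩

end

section Free

variable {n : ℕ}

/-- The coordinate functionals on a finite free right module. -/
def rightCoord (j : Fin n) : (Fin n → Aᵐᵒᵖ) →ₗ[Aᵐᵒᵖ] A where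
  toFun v := (v j).unop
  map_add' _ _ := rfl
  map_smul' _ _ := rfl

@[simp] theorem rightCoord_apply (j : Fin n) (v : Fin n → Aᵐᵒᵖ) :
    rightCoord j v = (v j).unop := rfl

theorem sum_smul_rightCoord (h : (Fin n → Aᵐᵒᵖ) →ₗ[Aᵐᵒᵖ] A) :
    ∑ j, h (Pi.single j 1) • rightCoord j = h := by
  refine (Pi.basisFun Aᵐᵒᵖ (Fin n)).ext fun j ↦ ?_
  rw [Pi.basisFun_apply, LinearMap.sum_apply, Finset.sum_eq_single j]
  · simp
  · intro k _ hk
    simp [hk]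
  · simp

variable (A n) in
theorem projective_rightDual_free : Module.Projective A ((Fin n → Aᵐᵒᵖ) →ₗ[Aᵐᵒᵖ] A) := by
  let φ : ((Fin n → Aᵐᵒᵖ) →ₗ[Aᵐᵒᵖ] A) →ₗ[A] (Fin n → A) :=
    LinearMap.pi fun j ↦ rightDualEval (Pi.single j 1)
  let ψ : (Fin n → A) →ₗ[A] ((Fin n → Aᵐᵒᵖ) →ₗ[Aᵐᵒᵖ] A) :=
    { toFun c := ∑ j, c j • rightCoord j
      map_add' c d := by simp [add_smul, Finset.sum_add_distrib]
      map_smul' a c := by simp [mul_smul, Finset.smul_sum] }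
  exact Module.Projective.of_split φ ψ (LinearMap.ext sum_smul_rightCoord)

variable (A n) in
theorem finite_rightDual_free : Module.Finite A ((Fin n → Aᵐᵒᵖ) →ₗ[Aᵐᵒᵖ] A) := by
  refine ⟨Submodule.fg_def.2 ⟨Set.range rightCoord, Set.finite_range _, ?_⟩⟩
  refine eq_top_iff.2 fun h _ ↦ ?_
  rw [← sum_smul_rightCoord h]
  exact sum_mem fun j _ ↦ Submodule.smul_mem _ _ (Submodule.subset_span ⟨j, rfl⟩)

theorem rightDualEval_surjective_free :
    Function.Surjective (rightDualEval (A := A) (X := Fin n → Aᵐᵒᵖ)) := by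
  intro φ
  refine ⟨fun j ↦ MulOpposite.op (φ (rightCoord j)), LinearMap.ext fun h ↦ ?_⟩
  rw [← sum_smul_rightCoord h]
  simp

theorem rightDualEval_injective_free :
    Function.Injective (rightDualEval (A := A) (X := Fin n → Aᵐᵒᵖ)) := by
  intro v w h
  funext j
  exact MulOpposite.unop_injective (LinearMap.congr_fun h (rightCoord j))

instance projective_of_pi_op : Projective (ModuleCat.of Aᵐᵒᵖ (Fin n → Aᵐᵒᵖ)) :=
  (IsProjective.iff_projective (R := Aᵐᵒᵖ) (Fin n → Aᵐᵒᵖ)).1 inferInstance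

end Free

namespace IsSemiGorensteinProjective

variable {n : ℕ} {g : (Fin n → Aᵐᵒᵖ) →ₗ[Aᵐᵒᵖ] X}

/-- The dual of a free presentation of a semi-Gorenstein-projective module. -/
theorem shortExact_rightDual (hX : IsSemiGorensteinProjective A X) (hg : Function.Surjective g) :
    (LinearMap.shortComplexOfExact _ _
      (exact_rightDualMap (A := A) (LinearMap.exact_subtype_ker_map g) hg)).ShortExact :=
  LinearMap.shortExact_shortComplexOfExact _ (rightDualMap_injective hg)
    (rightDualMap_surjective (LinearMap.exact_subtype_ker_map g)
      (Submodule.subtype_injective _) hg (hX.subsingleton_ext 0))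

theorem finite_rightDual [IsNoetherianRing A] (hX : IsSemiGorensteinProjective A X) :
    Module.Finite A (X →ₗ[Aᵐᵒᵖ] A) := by
  have := hX.finite
  obtain ⟨n, g, hg⟩ := Module.Finite.exists_fin' Aᵐᵒᵖ X
  have := finite_rightDual_free A n
  exact Module.Finite.of_injective (rightDualMap g) (rightDualMap_injective hg)

variable [IsNoetherianRing Aᵐᵒᵖ]

theorem ker (hX : IsSemiGorensteinProjective A X) (hg : Function.Surjective g) :
    IsSemiGorensteinProjective A (LinearMap.ker g) where
  finite := inferInstance
  subsingleton_ext i :=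
    (LinearMap.shortExact_shortComplexOfExact (LinearMap.exact_subtype_ker_map g)
      (Submodule.subtype_injective _) hg).subsingleton_ext_X₁ _ _
        (Abelian.Ext.subsingleton_of_projective (ModuleCat.of Aᵐᵒᵖ (Fin n → Aᵐᵒᵖ)) _ i)
        (hX.subsingleton_ext (i + 1))

theorem subsingleton_ext_rightDual (hA : ∃ n : ℕ, hasInjDimLE A n (ModuleCat.of A A))
    (hX : IsSemiGorensteinProjective A X) (i : ℕ) :
    Subsingleton (Abelian.Ext (ModuleCat.of A (X →ₗ[Aᵐᵒᵖ] A)) (ModuleCat.of A A) (i + 1)) := by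
  obtain ⟨m, hm⟩ := hA
  suffices H : ∀ (k : ℕ) (X : Type u) [AddCommGroup X] [Module Aᵐᵒᵖ X],
      IsSemiGorensteinProjective A X → ∀ i, m ≤ i + k →
        Subsingleton (Abelian.Ext (ModuleCat.of A (X →ₗ[Aᵐᵒᵖ] A)) (ModuleCat.of A A) (i + 1)) from
    H m X hX i (Nat.le_add_left _ _)
  intro k
  induction k with
  | zero => exact fun X _ _ _ i hi ↦ (subsingleton_extGrp_iff _ _ _).1 (hm (i + 1) (by lia) _)
  | succ k ih =>
    intro X _ _ hX i hi
    have := hX.finite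
    obtain ⟨n, g, hg⟩ := Module.Finite.exists_fin' Aᵐᵒᵖ X
    have : Projective (ModuleCat.of A ((Fin n → Aᵐᵒᵖ) →ₗ[Aᵐᵒᵖ] A)) :=
      (IsProjective.iff_projective (R := A) _).1 (projective_rightDual_free A n)
    exact (hX.shortExact_rightDual hg).subsingleton_ext_X₁ _ _
      (Abelian.Ext.subsingleton_of_projective
        (ModuleCat.of A ((Fin n → Aᵐᵒᵖ) →ₗ[Aᵐᵒᵖ] A)) _ i) (ih _ (hX.ker hg) (i + 1) (by lia))

theorem rightDualEval_surjective (hA : ∃ n : ℕ, hasInjDimLE A n (ModuleCat.of A A))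
    (hX : IsSemiGorensteinProjective A X) :
    Function.Surjective (rightDualEval (A := A) (X := X)) := by
  intro φ
  have := hX.finite
  obtain ⟨n, g, hg⟩ := Module.Finite.exists_fin' Aᵐᵒᵖ X
  obtain ⟨ψ, hψ⟩ := (hX.shortExact_rightDual hg).exists_extension_of_subsingleton_ext
    ((hX.ker hg).subsingleton_ext_rightDual hA 0) (ModuleCat.ofHom φ)
  obtain ⟨w, hw⟩ := rightDualEval_surjective_free ψ.hom
  refine ⟨g w, LinearMap.ext fun h ↦ ?_⟩
  exact (LinearMap.congr_fun hw (h ∘ₗ g)).trans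
    (LinearMap.congr_fun (congr_arg ModuleCat.Hom.hom hψ) h)

theorem rightDualEval_injective (hA : ∃ n : ℕ, hasInjDimLE A n (ModuleCat.of A A))
    (hX : IsSemiGorensteinProjective A X) {x : X} (hx : ∀ h : X →ₗ[Aᵐᵒᵖ] A, h x = 0) : x = 0 := by
  have := hX.finite
  obtain ⟨n, g, hg⟩ := Module.Finite.exists_fin' Aᵐᵒᵖ X
  obtain ⟨p, rfl⟩ := hg x
  have hsurj : Function.Surjective (rightDualMap (A := A) (LinearMap.ker g).subtype) :=
    rightDualMap_surjective (LinearMap.exact_subtype_ker_map g)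
      (Submodule.subtype_injective _) hg (hX.subsingleton_ext 0)
  set q := rightDualMap (A := A) (LinearMap.ker g).subtype
  have hle : LinearMap.ker q ≤ LinearMap.ker (rightDualEval (A := A) p) := by
    intro k hk
    obtain ⟨l, rfl⟩ :=
      (exact_rightDualMap (A := A) (LinearMap.exact_subtype_ker_map g) hg k).1 hk
    exact hx l
  obtain ⟨y, hy⟩ := (hX.ker hg).rightDualEval_surjective hA
    ((LinearMap.ker q).liftQ _ hle ∘ₗ (q.quotKerEquivOfSurjective hsurj).symm.toLinearMap)
  have : p = y := rightDualEval_injective_free (LinearMap.ext fun k ↦ by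
    have h₁ : (q.quotKerEquivOfSurjective hsurj).symm (q k) = (LinearMap.ker q).mkQ k :=
      (q.quotKerEquivOfSurjective hsurj).symm_apply_eq.2 rfl
    have h₂ := LinearMap.congr_fun hy (q k)
    rw [LinearMap.comp_apply, LinearEquiv.coe_coe, h₁, Submodule.mkQ_apply,
      Submodule.liftQ_apply] at h₂
    exact h₂.symm)
  rw [this]
  exact y.2

/-- Over a ring of finite injective dimension, semi-Gorenstein-projective modules are syzygies of
such modules. -/
theorem exists_cosyzygy [IsNoetherianRing A] (hA : ∃ n : ℕ, hasInjDimLE A n (ModuleCat.of A A))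
    (hX : IsSemiGorensteinProjective A X) :
    ∃ (n : ℕ) (f : X →ₗ[Aᵐᵒᵖ] (Fin n → Aᵐᵒᵖ)), Function.Injective f ∧
      IsSemiGorensteinProjective A ((Fin n → Aᵐᵒᵖ) ⧸ LinearMap.range f) := by
  have := hX.finite_rightDual
  obtain ⟨n, s, hs⟩ := Module.Finite.exists_fin (R := A) (M := X →ₗ[Aᵐᵒᵖ] A)
  have hspan (h : X →ₗ[Aᵐᵒᵖ] A) : ∃ c : Fin n → A, ∑ j, c j • s j = h :=
    (Submodule.mem_span_range_iff_exists_fun A).1 (hs ▸ Submodule.mem_top)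
  let f : X →ₗ[Aᵐᵒᵖ] (Fin n → Aᵐᵒᵖ) :=
    { toFun x j := MulOpposite.op (s j x)
      map_add' x y := by ext; simp
      map_smul' a x := by ext; simp }
  have hf : Function.Injective f := by
    refine (injective_iff_map_eq_zero f).2 fun x hx ↦ hX.rightDualEval_injective hA fun h ↦ ?_
    obtain ⟨c, rfl⟩ := hspan h
    have (j : Fin n) : s j x = 0 := MulOpposite.op_injective (congr_fun hx j)
    simp [LinearMap.sum_apply, this]
  have hS := LinearMap.shortExact_shortComplexOfExact (LinearMap.exact_map_mkQ_range f) hf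
    (Submodule.mkQ_surjective _)
  refine ⟨n, f, hf, inferInstance, fun i ↦ ?_⟩
  cases i with
  | zero =>
    refine hS.subsingleton_ext_one_of_exists_extension
      (Abelian.Ext.subsingleton_of_projective (ModuleCat.of Aᵐᵒᵖ (Fin n → Aᵐᵒᵖ)) _ 0) fun h ↦ ?_
    obtain ⟨c, hc⟩ := hspan h.hom
    refine ⟨ModuleCat.ofHom (∑ j, c j • rightCoord j), ?_⟩
    ext x
    rw [← hc]
    simp [LinearMap.sum_apply, f]
  | succ i =>
    exact hS.subsingleton_ext_X₃ _ _ (hX.subsingleton_ext i)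
      (Abelian.Ext.subsingleton_of_projective (ModuleCat.of Aᵐᵒᵖ (Fin n → Aᵐᵒᵖ)) _ (i + 1))

/-- If `Ext^i(-, K)` vanishes on finitely generated modules for large `i`, it vanishes on
semi-Gorenstein-projective modules for all positive `i`. -/
theorem subsingleton_ext_of_forall_le [IsNoetherianRing A]
    (hA : ∃ n : ℕ, hasInjDimLE A n (ModuleCat.of A A)) (K : ModuleCat.{u} Aᵐᵒᵖ) (d : ℕ)
    (hK : ∀ (L : ModuleCat.{u} Aᵐᵒᵖ) [Module.Finite Aᵐᵒᵖ L] (i : ℕ), d ≤ i →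
      Subsingleton (Abelian.Ext L K (i + 1)))
    (hX : IsSemiGorensteinProjective A X) (i : ℕ) :
    Subsingleton (Abelian.Ext (ModuleCat.of Aᵐᵒᵖ X) K (i + 1)) := by
  suffices H : ∀ (k : ℕ) (X : Type u) [AddCommGroup X] [Module Aᵐᵒᵖ X],
      IsSemiGorensteinProjective A X → ∀ i, d ≤ i + k →
        Subsingleton (Abelian.Ext (ModuleCat.of Aᵐᵒᵖ X) K (i + 1)) from
    H d X hX i (Nat.le_add_left _ _)
  intro k
  induction k with
  | zero =>
    intro X _ _ hX i hi
    have := hX.finite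
    exact hK _ i hi
  | succ k ih =>
    intro X _ _ hX i hi
    obtain ⟨n, f, hf, hZ⟩ := hX.exists_cosyzygy hA
    exact (LinearMap.shortExact_shortComplexOfExact (LinearMap.exact_map_mkQ_range f) hf
      (Submodule.mkQ_surjective _)).subsingleton_ext_X₁ _ _
        (Abelian.Ext.subsingleton_of_projective (ModuleCat.of Aᵐᵒᵖ (Fin n → Aᵐᵒᵖ)) _ i)
        (ih _ hZ (i + 1) (by lia))

end IsSemiGorensteinProjective

end Dual

theorem subsingleton_ext_congr_right {C : Type*} [Category* C] [Abelian C] [HasExt C]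
    {X Y Z : C} (e : Y ≅ Z) {n : ℕ} (h : Subsingleton (Abelian.Ext X Y n)) :
    Subsingleton (Abelian.Ext X Z n) := by
  refine ⟨fun a b ↦ ?_⟩
  have key (c : Abelian.Ext X Z n) : c = (c.comp (Abelian.Ext.mk₀ e.inv) (add_zero n)).comp
      (Abelian.Ext.mk₀ e.hom) (add_zero n) := by simp
  rw [key a, key b, Subsingleton.elim (a.comp (Abelian.Ext.mk₀ e.inv) (add_zero n)) _]

/-- The right regular module of `A`, as a module over `Aᵐᵒᵖ`. -/
def opLinearEquivMulOpposite (A : Type u) [Ring A] : Aᵐᵒᵖ ≃ₗ[Aᵐᵒᵖ] A where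
  __ := MulOpposite.opAddEquiv.symm
  map_smul' _ _ := rfl

theorem projective_of_shortExact_of_subsingleton_ext {B : Type u} [Ring B] {K P N : Type u}
    [AddCommGroup K] [Module B K] [AddCommGroup P] [Module B P] [AddCommGroup N] [Module B N]
    [Module.Projective B P] {f : K →ₗ[B] P} {g : P →ₗ[B] N} (hf : Function.Injective f)
    (hg : Function.Surjective g) (hfg : Function.Exact f g)
    (h : Subsingleton (Abelian.Ext (ModuleCat.of B N) (ModuleCat.of B K) 1)) :
    Module.Projective B N := by
  obtain ⟨r, hr⟩ := ShortComplex.ShortExact.exists_extension_of_subsingleton_ext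
    (LinearMap.shortExact_shortComplexOfExact hfg hf hg) h (𝟙 (ModuleCat.of B K))
  have split := (hfg.split_tfae hf hg).out 0 1
  obtain ⟨s, hs⟩ := split.2 ⟨r.hom, congrArg ModuleCat.Hom.hom hr⟩
  exact Module.Projective.of_split s g hs

/-- Let `R` be a commutative noetherian local ring of Krull dimension `d`, and
let `A` be a Noether `R`-algebra which is Iwanaga–Gorenstein (finite injective dimension as
a right and as a left `A`-module).  Let `N` be a finitely generated right `A`-module with
`Ext^i_A(N, A) = 0` for all `i > 0` which is not projective, and let `0 → K → P → N → 0` be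
a short exact sequence of right `A`-modules with `P` finitely generated projective.  Then
`Ext^{d+1}_A(A/rad A, K) ≠ 0`. -/
theorem ext_jacobson_syzygy_ne_zero
    (R : Type u) [CommRing R] [IsNoetherianRing R] [IsLocalRing R]
    (d : ℕ) (hd : ringKrullDim R = (d : WithBot ℕ∞))
    (A : Type u) [Ring A] [Algebra R A] [Module.Finite R A]
    -- `A` is Iwanaga–Gorenstein: finite injective dimension as a right `A`-module
    (hIGr : ∃ n : ℕ, hasInjDimLE Aᵐᵒᵖ n (ModuleCat.of Aᵐᵒᵖ Aᵐᵒᵖ))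
    -- ... and as a left `A`-module
    (hIGl : ∃ n : ℕ, hasInjDimLE A n (ModuleCat.of A A))
    (N : Type u) [AddCommGroup N] [Module Aᵐᵒᵖ N] [Module.Finite Aᵐᵒᵖ N]
    (hNext : ∀ i : ℕ, 0 < i →
      Subsingleton (extGrp Aᵐᵒᵖ i (ModuleCat.of Aᵐᵒᵖ N) (ModuleCat.of Aᵐᵒᵖ Aᵐᵒᵖ)))
    (hNproj : ¬ Module.Projective Aᵐᵒᵖ N)
    (K : Type u) [AddCommGroup K] [Module Aᵐᵒᵖ K]
    (P : Type u) [AddCommGroup P] [Module Aᵐᵒᵖ P] [Module.Finite Aᵐᵒᵖ P]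
    (hPproj : Module.Projective Aᵐᵒᵖ P)
    (f : K →ₗ[Aᵐᵒᵖ] P) (g : P →ₗ[Aᵐᵒᵖ] N)
    (hf : Function.Injective f) (hg : Function.Surjective g)
    (hfg : LinearMap.range f = LinearMap.ker g) :
    ¬ Subsingleton
      (extGrp Aᵐᵒᵖ (d + 1) (ModuleCat.of Aᵐᵒᵖ (modRad A)) (ModuleCat.of Aᵐᵒᵖ K)) := by
  intro h
  have : Module.Finite R Aᵐᵒᵖ := Module.Finite.equiv (MulOpposite.opLinearEquiv R)
  have : IsNoetherianRing A := isNoetherianRing_of_finite_algebra R A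
  have : IsNoetherianRing Aᵐᵒᵖ := isNoetherianRing_of_finite_algebra R Aᵐᵒᵖ
  have : Module.Finite Aᵐᵒᵖ K := Module.Finite.of_injective f hf
  rw [subsingleton_extGrp_iff] at h
  unfold modRad at h
  rw [radRight_eq_jacobson] at h
  have hN : IsSemiGorensteinProjective A N := ⟨inferInstance, fun i ↦
    subsingleton_ext_congr_right (opLinearEquivMulOpposite A).toModuleIso
      ((subsingleton_extGrp_iff _ _ _).1 (hNext (i + 1) i.succ_pos))⟩
  refine hNproj (projective_of_shortExact_of_subsingleton_ext hf hg
    (LinearMap.exact_iff.2 hfg.symm) (hN.subsingleton_ext_of_forall_le hIGl _ d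
      (fun L _ i hi ↦ ?_) 0))
  exact subsingleton_ext_of_simple_of_ringKrullDim_eq (R := R) d hd (ModuleCat.of Aᵐᵒᵖ K)
    (fun T _ ↦ subsingleton_ext_of_quotient_jacobson _ _
      (isSemisimpleModule_quotient_jacobson R Aᵐᵒᵖ) h T) L i hi
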